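/- (Soundararajan's Lemma.) Let (f(n))_{n≥1} and (λ_n)_{n≥1} be sequences of nonnegative real numbers, with (λ_n) non-decreasing and Σ_{n=1}^∞ f(n) < ∞. Let L ≥ 2 be an integer and Λ a positive real parameter. Suppose ℳ is a finite set of positive integers such that λ_m ∈ [Λ/2, 3Λ/2] for every m ∈ ℳ. Then for any real T ≥ 2 there exists some t ∈ [T/2, (6L)^{|ℳ|+1}·T] with Σ_{n=1}^∞ f(n) cos(2π λ_n t) ≥ (1/8) Σ_{m∈ℳ} f(m) − (1/(L−1)) Σ_{n : λ_n ≤ 2Λ} f(n) − (2/(π² T Λ)) Σ_{n=1}^∞ f(n). -/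

import Mathlib

open Real MeasureTheory FourierTransform

theorem integrable_sinc_sq : Integrable (fun u : ℝ => sinc (π * u) ^ 2) := by
  have h : Integrable (fun x : ℝ => sinc x ^ 2) := by
    refine (integrable_inv_one_add_sq.const_mul 2).mono'
      (by fun_prop) (Filter.Eventually.of_forall fun x => ?_)
    have h1 : sinc x ^ 2 ≤ 1 := by
      rw [sq_le_one_iff_abs_le_one]; exact abs_sinc_le_one x
    have h2 : x ^ 2 * sinc x ^ 2 ≤ 1 := by
      rcases eq_or_ne x 0 with rfl | hx
      · simp
      · rw [sinc_of_ne_zero hx]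
        have : x ^ 2 * (sin x / x) ^ 2 = sin x ^ 2 := by field_simp
        rw [this]; exact sin_sq_le_one x
    rw [norm_of_nonneg (sq_nonneg _), ← div_eq_mul_inv, le_div_iff₀ (by positivity)]
    linarith
  exact h.comp_mul_left' pi_ne_zero

theorem integral_one_sub_abs_mul_exp {c : ℂ} (hc : c ≠ 0) :
    ∫ v in (-1 : ℝ)..1, Complex.exp (c * v) * ((1 - |v| : ℝ) : ℂ)
      = (Complex.exp c + Complex.exp (-c) - 2) / c ^ 2 := by
  have hcont : Continuous fun v : ℝ => Complex.exp (c * v) * ((1 - |v| : ℝ) : ℂ) := by fun_prop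
  have hexp (v : ℝ) : HasDerivAt (fun v : ℝ => Complex.exp (c * v))
      (Complex.exp (c * v) * c) v := by
    have h := ((hasDerivAt_id v).ofReal_comp.const_mul c).cexp
    simpa using h
  have hid (v : ℝ) : HasDerivAt (fun v : ℝ => (v : ℂ)) 1 v := by
    simpa using (hasDerivAt_id v).ofReal_comp
  rw [← intervalIntegral.integral_add_adjacent_intervals (b := 0)
    (hcont.intervalIntegrable _ _) (hcont.intervalIntegrable _ _)]
  have hleft : ∫ v in (-1 : ℝ)..0, Complex.exp (c * v) * ((1 - |v| : ℝ) : ℂ)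
      = ((1 + ((0 : ℝ) : ℂ)) * (Complex.exp (c * (0 : ℝ)) / c) - Complex.exp (c * (0 : ℝ)) / c ^ 2)
        - ((1 + ((-1 : ℝ) : ℂ)) * (Complex.exp (c * (-1 : ℝ)) / c)
          - Complex.exp (c * (-1 : ℝ)) / c ^ 2) := by
    refine intervalIntegral.integral_eq_sub_of_hasDerivAt
      (f := fun v : ℝ => (1 + (v : ℂ)) * (Complex.exp (c * v) / c) - Complex.exp (c * v) / c ^ 2)
      (fun v hv => ?_) (hcont.intervalIntegrable _ _)
    rw [Set.uIcc_of_le (by norm_num)] at hv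
    refine ((((hid v).const_add 1).mul ((hexp v).div_const c)).sub
      ((hexp v).div_const (c ^ 2))).congr_deriv ?_
    rw [abs_of_nonpos hv.2]
    push_cast
    field_simp
    ring
  have hright : ∫ v in (0 : ℝ)..1, Complex.exp (c * v) * ((1 - |v| : ℝ) : ℂ)
      = ((1 - ((1 : ℝ) : ℂ)) * (Complex.exp (c * (1 : ℝ)) / c) + Complex.exp (c * (1 : ℝ)) / c ^ 2)
        - ((1 - ((0 : ℝ) : ℂ)) * (Complex.exp (c * (0 : ℝ)) / c)
          + Complex.exp (c * (0 : ℝ)) / c ^ 2) := by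
    refine intervalIntegral.integral_eq_sub_of_hasDerivAt
      (f := fun v : ℝ => (1 - (v : ℂ)) * (Complex.exp (c * v) / c) + Complex.exp (c * v) / c ^ 2)
      (fun v hv => ?_) (hcont.intervalIntegrable _ _)
    rw [Set.uIcc_of_le (by norm_num)] at hv
    refine ((((hid v).const_sub 1).mul ((hexp v).div_const c)).add
      ((hexp v).div_const (c ^ 2))).congr_deriv ?_
    rw [abs_of_nonneg hv.1]
    push_cast
    field_simp
    ring
  rw [hleft, hright]
  simp
  field_simp
  ring

theorem integral_one_sub_abs : ∫ v in (-1 : ℝ)..1, (1 - |v|) = 1 := by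
  have hcont : Continuous fun v : ℝ => 1 - |v| := by fun_prop
  rw [← intervalIntegral.integral_add_adjacent_intervals (b := 0)
    (hcont.intervalIntegrable _ _) (hcont.intervalIntegrable _ _)]
  have hleft : ∫ v in (-1 : ℝ)..0, (1 - |v|) = ∫ v in (-1 : ℝ)..0, (1 + v) :=
    intervalIntegral.integral_congr fun v hv => by
      rw [Set.uIcc_of_le (by norm_num)] at hv
      simp only [abs_of_nonpos hv.2]; ring
  have hright : ∫ v in (0 : ℝ)..1, (1 - |v|) = ∫ v in (0 : ℝ)..1, (1 - v) :=
    intervalIntegral.integral_congr fun v hv => by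
      rw [Set.uIcc_of_le (by norm_num)] at hv
      simp only [abs_of_nonneg hv.1]
  rw [hleft, hright, intervalIntegral.integral_add (by simp) (by simp),
    intervalIntegral.integral_sub (by simp) (by simp)]
  norm_num

/-- The triangle function supported on `[-1, 1]`. -/
noncomputable def triangle (y : ℝ) : ℝ := max 0 (1 - |y|)

theorem continuous_triangle : Continuous triangle := by unfold triangle; fun_prop

theorem triangle_eq_zero {y : ℝ} (hy : 1 ≤ |y|) : triangle y = 0 :=
  max_eq_left (by linarith)

theorem triangle_eq {y : ℝ} (hy : |y| ≤ 1) : triangle y = 1 - |y| :=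
  max_eq_right (by linarith)

theorem fourier_triangle :
    𝓕 (fun y => (triangle y : ℂ)) = fun u : ℝ => ((sinc (π * u) ^ 2 : ℝ) : ℂ) := by
  ext u
  have hset : 𝓕 (fun y => (triangle y : ℂ)) u
      = ∫ v in (-1 : ℝ)..1, Complex.exp ((-2 * π * u * Complex.I) * v) * ((1 - |v| : ℝ) : ℂ) := by
    rw [fourier_real_eq_integral_exp_smul, intervalIntegral.integral_of_le (by norm_num),
      ← integral_Icc_eq_integral_Ioc, ← setIntegral_eq_integral_of_forall_compl_eq_zero
        (s := Set.Icc (-1 : ℝ) 1)]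
    · refine setIntegral_congr_fun measurableSet_Icc fun v hv => ?_
      simp only [smul_eq_mul]
      rw [triangle_eq (abs_le.2 hv)]
      congr 2
      push_cast
      ring
    · intro v hv
      rw [triangle_eq_zero]
      · simp
      · by_contra! h
        exact hv (abs_le.1 h.le)
  rw [hset]
  rcases eq_or_ne u 0 with rfl | hu
  · simp only [Complex.ofReal_zero, mul_zero, zero_mul, Complex.exp_zero, one_mul]
    rw [intervalIntegral.integral_ofReal, integral_one_sub_abs]
    simp
  · have hpu : π * u ≠ 0 := mul_ne_zero pi_ne_zero hu
    have hc : (-2 * π * u * Complex.I : ℂ) ≠ 0 := by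
      simp [hu, pi_ne_zero]
    rw [integral_one_sub_abs_mul_exp hc, sinc_of_ne_zero hpu]
    have hsum : Complex.exp (-2 * π * u * Complex.I) + Complex.exp (-(-2 * π * u * Complex.I))
        = 2 - 4 * Complex.sin (π * u) ^ 2 := by
      have h := Complex.two_cos (2 * (π * u))
      rw [Complex.cos_two_mul, Complex.cos_sq'] at h
      rw [show (-2 * π * u * Complex.I : ℂ) = -(2 * (π * u)) * Complex.I by ring,
        show -(-(2 * (π * u)) * Complex.I : ℂ) = (2 * (π * u)) * Complex.I by ring,
        add_comm, ← h]
      ring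
    rw [hsum]
    have hu' : (u : ℂ) ≠ 0 := by exact_mod_cast hu
    have hp' : (π : ℂ) ≠ 0 := by exact_mod_cast pi_ne_zero
    push_cast
    rw [mul_pow _ Complex.I, Complex.I_sq]
    field_simp
    ring

theorem integral_sinc_sq_mul_exp (y : ℝ) :
    ∫ u : ℝ, Complex.exp ((2 * π * u * y : ℝ) * Complex.I) * ((sinc (π * u) ^ 2 : ℝ) : ℂ)
      = triangle y := by
  have hint : Integrable (fun y => (triangle y : ℂ)) := by
    refine Continuous.integrable_of_hasCompactSupport
      (Complex.continuous_ofReal.comp continuous_triangle)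
      (HasCompactSupport.intro (isCompact_Icc (a := (-1 : ℝ)) (b := 1)) fun v hv => ?_)
    rw [triangle_eq_zero]
    · simp
    · by_contra! h
      exact hv (abs_le.1 h.le)
  have h := Continuous.fourierInv_fourier_eq
    (Complex.continuous_ofReal.comp continuous_triangle) hint
    (by
      change Integrable (𝓕 (fun y => (triangle y : ℂ)))
      rw [fourier_triangle]; exact integrable_sinc_sq.ofReal)
  have h' := congrFun h y
  change 𝓕⁻ (𝓕 (fun y => (triangle y : ℂ))) y = _ at h'
  rw [fourier_triangle, fourierInv_eq'] at h'
  simp only [smul_eq_mul, Function.comp_apply] at h'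
  rw [← h']
  congr 1
  ext u
  simp [mul_comm, mul_assoc]

theorem integral_sinc_sq_mul_cos (y θ : ℝ) :
    ∫ u : ℝ, sinc (π * u) ^ 2 * cos (2 * π * u * y + θ) = triangle y * cos θ := by
  have h := congrArg (fun z : ℂ => (Complex.exp (θ * Complex.I) * z).re)
    (integral_sinc_sq_mul_exp y)
  beta_reduce at h
  rw [← integral_const_mul] at h
  have hint : Integrable (fun u : ℝ => Complex.exp (θ * Complex.I) *
      (Complex.exp ((2 * π * u * y : ℝ) * Complex.I) * ((sinc (π * u) ^ 2 : ℝ) : ℂ))) := by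
    refine Integrable.const_mul (Integrable.bdd_mul (c := 1) integrable_sinc_sq.ofReal
      (by fun_prop) (Filter.Eventually.of_forall fun u => ?_)) _
    rw [Complex.norm_exp_ofReal_mul_I]
  have hre := integral_re hint
  simp only [RCLike.re_to_complex] at hre
  rw [← hre] at h
  rw [Complex.re_mul_ofReal, Complex.exp_ofReal_mul_I_re, mul_comm (cos θ)] at h
  rw [← h]
  congr 1
  ext u
  rw [← mul_assoc, ← Complex.exp_add, ← add_mul, ← Complex.ofReal_add, Complex.re_mul_ofReal,
    Complex.exp_ofReal_mul_I_re, add_comm, mul_comm]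

/-- The Fejér kernel with spectrum in `[-2Λ, 2Λ]`, normalised to have integral one. -/
noncomputable def fejerKernel (Λ u : ℝ) : ℝ := 2 * Λ * sinc (π * (2 * Λ * u)) ^ 2

section FejerKernel

variable {Λ : ℝ}

theorem fejerKernel_nonneg (hΛ : 0 < Λ) (u : ℝ) : 0 ≤ fejerKernel Λ u := by
  unfold fejerKernel; positivity

theorem fejerKernel_neg (Λ u : ℝ) : fejerKernel Λ (-u) = fejerKernel Λ u := by
  simp [fejerKernel]

theorem integrable_fejerKernel (hΛ : 0 < Λ) : Integrable (fejerKernel Λ) :=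
  (integrable_sinc_sq.comp_mul_left' (by positivity : 2 * Λ ≠ 0)).const_mul (2 * Λ)

theorem integral_fejerKernel_mul_cos (hΛ : 0 < Λ) (y t : ℝ) :
    ∫ u, fejerKernel Λ u * cos (2 * π * y * (t + u))
      = triangle (y / (2 * Λ)) * cos (2 * π * y * t) := by
  have h := Measure.integral_comp_mul_left (fun u : ℝ => sinc (π * u) ^ 2 *
    cos (2 * π * u * (y / (2 * Λ)) + 2 * π * y * t)) (2 * Λ)
  rw [integral_sinc_sq_mul_cos, abs_of_pos (by positivity), smul_eq_mul] at h
  have h2 : ∫ u, fejerKernel Λ u * cos (2 * π * y * (t + u)) = 2 * Λ * ∫ u : ℝ,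
      sinc (π * (2 * Λ * u)) ^ 2 * cos (2 * π * (2 * Λ * u) * (y / (2 * Λ)) + 2 * π * y * t) := by
    rw [← integral_const_mul]
    congr 1
    ext u
    rw [fejerKernel, mul_assoc]
    congr 3
    field_simp
    ring
  rw [h2, h]
  field_simp

theorem integral_fejerKernel (hΛ : 0 < Λ) : ∫ u, fejerKernel Λ u = 1 := by
  simpa [triangle] using integral_fejerKernel_mul_cos hΛ 0 0

theorem integral_Ioi_fejerKernel_le (hΛ : 0 < Λ) {a : ℝ} (ha : 0 < a) :
    ∫ u in Set.Ioi a, fejerKernel Λ u ≤ 1 / (2 * π ^ 2 * Λ * a) := by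
  have hbound : ∀ u ∈ Set.Ioi a,
      fejerKernel Λ u ≤ 1 / (2 * π ^ 2 * Λ) * u ^ (-2 : ℝ) := by
    intro u hu
    have hu0 : 0 < u := ha.trans hu
    have hne : π * (2 * Λ * u) ≠ 0 := by positivity
    rw [fejerKernel, sinc_of_ne_zero hne, rpow_neg hu0.le, rpow_two]
    have hs := sin_sq_le_one (π * (2 * Λ * u))
    calc 2 * Λ * (sin (π * (2 * Λ * u)) / (π * (2 * Λ * u))) ^ 2
        = sin (π * (2 * Λ * u)) ^ 2 * (1 / (2 * π ^ 2 * Λ) * (u ^ 2)⁻¹) := by field_simp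
      _ ≤ 1 * (1 / (2 * π ^ 2 * Λ) * (u ^ 2)⁻¹) := by gcongr
      _ = _ := one_mul _
  have hr : ((-2 : ℝ)) < -1 := by norm_num
  refine (setIntegral_mono_on (integrable_fejerKernel hΛ).integrableOn
    ((integrableOn_Ioi_rpow_of_lt hr ha).const_mul _) measurableSet_Ioi hbound).trans_eq ?_
  rw [integral_const_mul, integral_Ioi_rpow_of_lt hr ha]
  norm_num [rpow_neg_one]
  field_simp

theorem integral_Iic_fejerKernel_le (hΛ : 0 < Λ) {a : ℝ} (ha : 0 < a) :
    ∫ u in Set.Iic (-a), fejerKernel Λ u ≤ 1 / (2 * π ^ 2 * Λ * a) := by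
  have h := integral_comp_neg_Ioi a (fejerKernel Λ)
  simp only [fejerKernel_neg] at h
  rw [← h]
  exact integral_Ioi_fejerKernel_le hΛ ha

/-- If a function bounded by `S` is at most `C` on `[t - T / 2, t + 2 * T]`, its Fejér mean at `t`
exceeds `C` by at most the contribution of the tails of the kernel. -/
theorem integral_fejerKernel_mul_le (hΛ : 0 < Λ) {F : ℝ → ℝ} (hF : Continuous F) {S C t T : ℝ}
    (hT : 0 < T) (hFS : ∀ x, |F x| ≤ S) (hCS : C ≤ S)
    (hFC : ∀ x ∈ Set.Icc (t - T / 2) (t + 2 * T), F x ≤ C) :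
    ∫ u, fejerKernel Λ u * F (t + u) ≤ C + (S - C) * (5 / (4 * π ^ 2 * T * Λ)) := by
  have hW := integrable_fejerKernel hΛ
  have hlow := hW.indicator (measurableSet_Iic (a := -(T / 2)))
  have hhigh := hW.indicator (measurableSet_Ioi (a := 2 * T))
  have hint : Integrable fun u => fejerKernel Λ u * F (t + u) :=
    hW.mul_bdd (c := S) (by fun_prop) (Filter.Eventually.of_forall fun u => hFS _)
  have hmono : ∫ u, fejerKernel Λ u * F (t + u) ≤ ∫ u, (fejerKernel Λ u * C + (S - C) *
      ((Set.Iic (-(T / 2))).indicator (fejerKernel Λ) u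
        + (Set.Ioi (2 * T)).indicator (fejerKernel Λ) u)) := by
    refine integral_mono hint ((hW.mul_const C).add ((hlow.add hhigh).const_mul _)) fun u => ?_
    have hWu := fejerKernel_nonneg hΛ u
    have hFu := (abs_le.1 (hFS (t + u))).2
    have hi₁ := Set.indicator_nonneg (s := Set.Iic (-(T / 2))) (f := fejerKernel Λ)
      (fun x _ => fejerKernel_nonneg hΛ x) u
    have hi₂ := Set.indicator_nonneg (s := Set.Ioi (2 * T)) (f := fejerKernel Λ)
      (fun x _ => fejerKernel_nonneg hΛ x) u
    have hSC : 0 ≤ S - C := by linarith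
    have hWF : fejerKernel Λ u * F (t + u) ≤ fejerKernel Λ u * S := by gcongr
    beta_reduce
    rcases le_or_gt u (-(T / 2)) with h₁ | h₁
    · rw [Set.indicator_of_mem (Set.mem_Iic.2 h₁)]
      nlinarith
    rcases lt_or_ge (2 * T) u with h₂ | h₂
    · rw [Set.indicator_of_mem (Set.mem_Ioi.2 h₂)]
      nlinarith
    · have : fejerKernel Λ u * F (t + u) ≤ fejerKernel Λ u * C := by
        gcongr
        exact hFC _ ⟨by linarith, by linarith⟩
      nlinarith
  refine hmono.trans ?_
  have hsum : Integrable fun u => (S - C) * ((Set.Iic (-(T / 2))).indicator (fejerKernel Λ) u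
      + (Set.Ioi (2 * T)).indicator (fejerKernel Λ) u) := (hlow.add hhigh).const_mul _
  rw [integral_add (hW.mul_const C) hsum, integral_mul_const,
    integral_const_mul, integral_add hlow hhigh, integral_indicator measurableSet_Iic,
    integral_indicator measurableSet_Ioi, integral_fejerKernel hΛ, one_mul]
  have h₁ := integral_Iic_fejerKernel_le hΛ (half_pos hT)
  have h₂ := integral_Ioi_fejerKernel_le hΛ (mul_pos two_pos hT)
  have h₃ : 1 / (2 * π ^ 2 * Λ * (T / 2)) + 1 / (2 * π ^ 2 * Λ * (2 * T))
      = 5 / (4 * π ^ 2 * T * Λ) := by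
    field_simp
    norm_num
  rw [← h₃]
  have hSC : 0 ≤ S - C := by linarith
  gcongr

end FejerKernel

section CosineSeries

variable {ι : Type*} {f lam : ι → ℝ}

theorem abs_mul_cos_le (hf : ∀ n, 0 ≤ f n) (n : ι) (x : ℝ) : |f n * cos x| ≤ f n := by
  rw [abs_mul, abs_of_nonneg (hf n)]
  exact mul_le_of_le_one_right (hf n) (abs_cos_le_one x)

theorem summable_mul_cos (hf : ∀ n, 0 ≤ f n) (hs : Summable f) (x : ι → ℝ) :
    Summable fun n => f n * cos (x n) :=
  Summable.of_norm_bounded hs fun n => abs_mul_cos_le hf n _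

theorem continuous_tsum_mul_cos (hf : ∀ n, 0 ≤ f n) (hs : Summable f) :
    Continuous fun t : ℝ => ∑' n, f n * cos (2 * π * lam n * t) :=
  continuous_tsum (fun n => by fun_prop) hs fun n _ => abs_mul_cos_le hf n _

theorem abs_tsum_mul_cos_le (hf : ∀ n, 0 ≤ f n) (hs : Summable f) (x : ι → ℝ) :
    |∑' n, f n * cos (x n)| ≤ ∑' n, f n :=
  tsum_of_norm_bounded (f := fun n => f n * cos (x n)) hs.hasSum fun n => abs_mul_cos_le hf n _

theorem integral_fejerKernel_mul_tsum [Countable ι] {Λ : ℝ} (hΛ : 0 < Λ) (hf : ∀ n, 0 ≤ f n)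
    (hs : Summable f) (t : ℝ) :
    ∫ u, fejerKernel Λ u * ∑' n, f n * cos (2 * π * lam n * (t + u))
      = ∑' n, f n * (triangle (lam n / (2 * Λ)) * cos (2 * π * lam n * t)) := by
  have hW := integrable_fejerKernel hΛ
  have hint (n : ι) :
      Integrable fun u => fejerKernel Λ u * (f n * cos (2 * π * lam n * (t + u))) :=
    hW.mul_bdd (c := f n) (by fun_prop) (Filter.Eventually.of_forall fun u => abs_mul_cos_le hf n _)
  have hnorm (n : ι) :
      ∫ u, ‖fejerKernel Λ u * (f n * cos (2 * π * lam n * (t + u)))‖ ≤ f n := by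
    calc _ ≤ ∫ u, fejerKernel Λ u * f n := by
          refine integral_mono (hint n).norm (hW.mul_const _) fun u => ?_
          beta_reduce
          rw [norm_mul, norm_of_nonneg (fejerKernel_nonneg hΛ u)]
          exact mul_le_mul_of_nonneg_left (abs_mul_cos_le hf n _) (fejerKernel_nonneg hΛ u)
      _ = f n := by rw [integral_mul_const, integral_fejerKernel hΛ, one_mul]
  have h := hasSum_integral_of_summable_integral_norm hint
    (Summable.of_nonneg_of_le (fun n => integral_nonneg fun u => norm_nonneg _) hnorm hs)
  simp_rw [tsum_mul_left] at h
  rw [← h.tsum_eq]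
  congr 1
  ext n
  rw [← integral_fejerKernel_mul_cos hΛ, ← integral_const_mul]
  congr 1
  ext u
  ring

/-- Doubling the argument keeps a cosine series from being close to its absolute minimum. -/
theorem neg_le_tsum_mul_cos_or_double (hf : ∀ n, 0 ≤ f n) (hs : Summable f) (t : ℝ) :
    -(9 / 8) * ∑' n, f n ≤ ∑' n, f n * cos (2 * π * lam n * t)
      + ∑' n, f n * cos (2 * π * lam n * (2 * t)) := by
  have h₁ := summable_mul_cos hf hs fun n => 2 * π * lam n * t
  have h₂ := summable_mul_cos hf hs fun n => 2 * π * lam n * (2 * t)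
  rw [← h₁.tsum_add h₂, ← tsum_mul_left]
  refine (hs.mul_left _).tsum_le_tsum (fun n => ?_) (h₁.add h₂)
  rw [show 2 * π * lam n * (2 * t) = 2 * (2 * π * lam n * t) by ring, cos_two_mul]
  have := mul_nonneg (hf n) (sq_nonneg (4 * cos (2 * π * lam n * t) + 1))
  nlinarith

end CosineSeries

theorem sum_range_sub_mul_cos (L : ℕ) (θ : ℝ) :
    2 * ∑ l ∈ Finset.range L, ((L : ℝ) - l) * cos (l * θ) - L
      = (∑ l ∈ Finset.range L, cos (l * θ)) ^ 2 + (∑ l ∈ Finset.range L, sin (l * θ)) ^ 2 := by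
  induction L with
  | zero => simp
  | succ L ih =>
    have hcross : cos (L * θ) * ∑ l ∈ Finset.range L, cos (l * θ)
        + sin (L * θ) * ∑ l ∈ Finset.range L, sin (l * θ)
        = ∑ l ∈ Finset.range L, cos ((l + 1 : ℕ) * θ) := by
      rw [Finset.mul_sum, Finset.mul_sum, ← Finset.sum_add_distrib,
        ← Finset.sum_range_reflect (fun l : ℕ => cos ((l + 1 : ℕ) * θ))]
      refine Finset.sum_congr rfl fun l hl => ?_
      have hl' := Finset.mem_range.1 hl
      rw [← cos_sub, show L - 1 - l + 1 = L - l by omega, Nat.cast_sub hl'.le, sub_mul]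
    have hshift := Finset.sum_range_succ' (fun l : ℕ => cos (l * θ)) L
    have hstep : ∑ l ∈ Finset.range (L + 1), (((L + 1 : ℕ) : ℝ) - l) * cos (l * θ)
        = ∑ l ∈ Finset.range L, ((L : ℝ) - l) * cos (l * θ)
          + ∑ l ∈ Finset.range (L + 1), cos (l * θ) := by
      rw [Finset.sum_range_succ _ L, Finset.sum_range_succ _ L, ← add_assoc,
        ← Finset.sum_add_distrib]
      push_cast
      congr 1
      · exact Finset.sum_congr rfl fun l _ => by ring
      · ring
    have hsq := sin_sq_add_cos_sq (L * θ)
    rw [Finset.sum_range_succ, ← hcross, Nat.cast_zero, zero_mul, cos_zero] at hshift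
    rw [hstep, Finset.sum_range_succ (fun l : ℕ => cos (l * θ)),
      Finset.sum_range_succ (fun l : ℕ => sin (l * θ))]
    push_cast
    linear_combination ih + 2 * hshift - hsq

theorem neg_half_le_sum_sub_mul_cos {L : ℕ} (hL : 0 < L) (θ : ℝ) :
    -((L : ℝ) / 2) ≤ ∑ l ∈ Finset.Ico 1 L, ((L : ℝ) - l) * cos (l * θ) := by
  have h := sum_range_sub_mul_cos L θ
  rw [Finset.range_eq_Ico, Finset.sum_eq_sum_Ico_succ_bot hL] at h
  simp only [Nat.cast_zero, sub_zero, zero_mul, cos_zero, mul_one, zero_add] at h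
  nlinarith [sq_nonneg (∑ l ∈ Finset.Ico 0 L, cos (l * θ)),
    sq_nonneg (∑ l ∈ Finset.Ico 0 L, sin (l * θ))]

theorem sum_Ico_sub {L : ℕ} (hL : 0 < L) :
    ∑ l ∈ Finset.Ico 1 L, ((L : ℝ) - l) = L * (L - 1) / 2 := by
  have h := sum_range_sub_mul_cos L 0
  rw [Finset.range_eq_Ico, Finset.sum_eq_sum_Ico_succ_bot hL] at h
  simp at h
  simp
  linarith

theorem half_le_cos_of_near_int {L l : ℕ} (hl : l ≤ L) {x : ℝ} {j : ℤ}
    (hx : |x - j| ≤ 1 / ((6 * L : ℕ) : ℝ)) : 1 / 2 ≤ cos (l * (2 * π * x)) := by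
  have hcos : cos (l * (2 * π * x)) = cos |l * (2 * π * (x - j))| := by
    rw [cos_abs, ← cos_sub_int_mul_two_pi _ (l * j)]
    congr 1
    push_cast
    ring
  rw [hcos, ← cos_pi_div_three]
  have hp := pi_pos
  have hbound : |l * (2 * π * (x - j))| ≤ π / 3 := by
    rw [abs_mul, abs_mul, abs_of_nonneg (Nat.cast_nonneg l), abs_of_pos (by positivity)]
    calc (l : ℝ) * (2 * π * |x - j|) ≤ L * (2 * π * (1 / ((6 * L : ℕ) : ℝ))) := by gcongr
      _ ≤ π / 3 := by
        rcases Nat.eq_zero_or_pos L with rfl | hL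
        · simp; positivity
        · refine le_of_eq ?_
          push_cast
          field_simp
          norm_num
  exact cos_le_cos_of_nonneg_of_le_pi (abs_nonneg _) (by linarith) hbound

/-- Dirichlet's simultaneous approximation theorem. -/
theorem exists_nat_mul_near_int {ι : Type*} (s : Finset ι) (x : ι → ℝ) {N : ℕ} (hN : 0 < N) :
    ∃ k : ℕ, 1 ≤ k ∧ k ≤ N ^ s.card ∧ ∀ m ∈ s, ∃ j : ℤ, |k * x m - j| ≤ 1 / (N : ℝ) := by
  classical
  have hN' : (0 : ℝ) < N := by exact_mod_cast hN
  have hlt (k : ℕ) (m : ι) : ⌊N * Int.fract (k * x m)⌋₊ < N := by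
    rw [Nat.floor_lt (by positivity)]
    nlinarith [Int.fract_lt_one (k * x m)]
  let g : Fin (N ^ s.card + 1) → (s → Fin N) := fun k m => ⟨_, hlt k m⟩
  obtain ⟨a, b, hab, hg⟩ := Fintype.exists_ne_map_eq_of_card_lt g (by simp)
  wlog hba : b < a generalizing a b
  · exact this b a hab.symm hg.symm (lt_of_le_of_ne (not_lt.1 hba) hab)
  have hba' : (b : ℕ) < a := hba
  refine ⟨a - b, by omega, by omega, fun m hm => ⟨⌊a * x m⌋ - ⌊b * x m⌋, ?_⟩⟩
  have hfl : ⌊N * Int.fract (a * x m)⌋₊ = ⌊N * Int.fract (b * x m)⌋₊ :=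
    congrArg Fin.val (congrFun hg ⟨m, hm⟩)
  have h₁ := Nat.floor_le (a := N * Int.fract (a * x m)) (by positivity)
  have h₂ := Nat.lt_floor_add_one (N * Int.fract (a * x m))
  have h₃ := Nat.floor_le (a := N * Int.fract (b * x m)) (by positivity)
  have h₄ := Nat.lt_floor_add_one (N * Int.fract (b * x m))
  rw [hfl] at h₁ h₂
  have hfract : ((a - b : ℕ) : ℝ) * x m - ((⌊a * x m⌋ - ⌊b * x m⌋ : ℤ) : ℝ)
      = Int.fract (a * x m) - Int.fract (b * x m) := by
    rw [Nat.cast_sub hba'.le, Int.fract, Int.fract]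
    push_cast
    ring
  rw [hfract, abs_le, neg_le, le_div_iff₀ hN', le_div_iff₀ hN']
  constructor <;> linarith

section Resonance

variable {ι : Type*} {f lam : ι → ℝ} {L : ℕ} {Λ : ℝ} {M : Finset ι}

theorem exists_le_tsum_triangle_mul_cos (hf : ∀ n, 0 ≤ f n) (hlam : ∀ n, 0 ≤ lam n)
    (hs : Summable f) (hL : 2 ≤ L) (hΛ : 0 < Λ)
    (hM : ∀ m ∈ M, lam m ∈ Set.Icc (Λ / 2) (3 * Λ / 2)) {t : ℝ}
    (ht : ∀ m ∈ M, ∃ j : ℤ, |lam m * t - j| ≤ 1 / ((6 * L : ℕ) : ℝ)) :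
    ∃ l ∈ Finset.Ico 1 L,
      (1 / 8) * ∑ m ∈ M, f m - (1 / ((L : ℝ) - 1)) * ∑' n, {n | lam n ≤ 2 * Λ}.indicator f n
        ≤ ∑' n, f n * (triangle (lam n / (2 * Λ)) * cos (2 * π * lam n * (l * t))) := by
  have hL' : (2 : ℝ) ≤ L := by exact_mod_cast hL
  have hL1 : (L : ℝ) - 1 ≠ 0 := by linarith
  have htri (n : ι) : 0 ≤ triangle (lam n / (2 * Λ)) := le_max_left _ _
  have htri_le (n : ι) : triangle (lam n / (2 * Λ)) ≤ 1 :=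
    max_le zero_le_one (by linarith [abs_nonneg (lam n / (2 * Λ))])
  have hsum (l : ℕ) : Summable fun n =>
      f n * (triangle (lam n / (2 * Λ)) * cos (2 * π * lam n * (l * t))) := by
    have hft : Summable fun n => f n * triangle (lam n / (2 * Λ)) :=
      Summable.of_nonneg_of_le (fun n => mul_nonneg (hf n) (htri n))
        (fun n => mul_le_of_le_one_right (hf n) (htri_le n)) hs
    simpa only [mul_assoc] using summable_mul_cos (fun n => mul_nonneg (hf n) (htri n)) hft
      fun n => 2 * π * lam n * (l * t)
  have hMsum : HasSum ((M : Set ι).indicator f) (∑ m ∈ M, f m) :=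
    hasSum_subtype_iff_indicator.1 (Finset.hasSum M f)
  set B := ∑' n, {n | lam n ≤ 2 * Λ}.indicator f n
  have hBsum : HasSum ({n | lam n ≤ 2 * Λ}.indicator f) B := (hs.indicator _).hasSum
  have hlower := (hMsum.mul_left ((L : ℝ) * (L - 1) / 16)).sub (hBsum.mul_left ((L : ℝ) / 2))
  have hupper : HasSum (fun n => ∑ l ∈ Finset.Ico 1 L, ((L : ℝ) - l) *
      (f n * (triangle (lam n / (2 * Λ)) * cos (2 * π * lam n * (l * t)))))
      (∑ l ∈ Finset.Ico 1 L, ((L : ℝ) - l) *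
        ∑' n, f n * (triangle (lam n / (2 * Λ)) * cos (2 * π * lam n * (l * t)))) :=
    hasSum_sum fun l _ => (hsum l).hasSum.mul_left _
  have hle := hasSum_le (fun n => ?_) hlower hupper
  · have hne : (Finset.Ico 1 L).Nonempty := ⟨1, by simp; omega⟩
    obtain ⟨l, hl, h⟩ := Finset.exists_le_of_sum_le hne (f := fun l : ℕ => ((L : ℝ) - l) *
      ((1 / 8) * ∑ m ∈ M, f m - (1 / ((L : ℝ) - 1)) * B)) (g := fun l : ℕ => ((L : ℝ) - l) *
        ∑' n, f n * (triangle (lam n / (2 * Λ)) * cos (2 * π * lam n * (l * t)))) (by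
        rw [← Finset.sum_mul, sum_Ico_sub (by omega)]
        refine le_of_eq_of_le ?_ hle
        field_simp
        ring)
    refine ⟨l, hl, le_of_mul_le_mul_left h ?_⟩
    have hlL : (l : ℝ) < L := by exact_mod_cast (Finset.mem_Ico.1 hl).2
    linarith
  · set D := ∑ l ∈ Finset.Ico 1 L, ((L : ℝ) - l) * cos (l * (2 * π * (lam n * t))) with hD
    have hfactor : ∑ l ∈ Finset.Ico 1 L, ((L : ℝ) - l) *
        (f n * (triangle (lam n / (2 * Λ)) * cos (2 * π * lam n * (l * t))))
        = f n * triangle (lam n / (2 * Λ)) * D := by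
      rw [hD, Finset.mul_sum]
      refine Finset.sum_congr rfl fun l _ => ?_
      rw [show 2 * π * lam n * (l * t) = l * (2 * π * (lam n * t)) by ring]
      ring
    rw [hfactor]
    have hBn : 0 ≤ {n | lam n ≤ 2 * Λ}.indicator f n :=
      Set.indicator_nonneg (fun n _ => hf n) n
    by_cases hn : n ∈ M
    · rw [Set.indicator_of_mem (Finset.mem_coe.2 hn)]
      obtain ⟨hlo, hhi⟩ := hM n hn
      obtain ⟨j, hj⟩ := ht n hn
      have hDn : (L : ℝ) * (L - 1) / 4 ≤ D := by
        calc (L : ℝ) * (L - 1) / 4 = ∑ l ∈ Finset.Ico 1 L, ((L : ℝ) - l) * (1 / 2) := by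
              rw [← Finset.sum_mul, sum_Ico_sub (by omega)]; ring
          _ ≤ D := by
            refine Finset.sum_le_sum fun l hl => ?_
            have hlL := (Finset.mem_Ico.1 hl).2.le
            have : (l : ℝ) ≤ L := by exact_mod_cast hlL
            exact mul_le_mul_of_nonneg_left (half_le_cos_of_near_int hlL hj) (by linarith)
      have htn : 1 / 4 ≤ triangle (lam n / (2 * Λ)) := by
        refine le_max_of_le_right ?_
        rw [abs_of_nonneg (by have := hlam n; positivity)]
        have : lam n / (2 * Λ) ≤ 3 / 4 := by
          rw [div_le_iff₀ (by positivity)]; linarith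
        linarith
      have hLL : 0 ≤ (L : ℝ) * (L - 1) / 4 := by
        have : 0 ≤ (L : ℝ) - 1 := by linarith
        positivity
      have hprod : (1 / 4) * ((L : ℝ) * (L - 1) / 4) ≤ triangle (lam n / (2 * Λ)) * D := by
        gcongr
      have := mul_le_mul_of_nonneg_left hprod (hf n)
      nlinarith
    · rw [Set.indicator_of_notMem (by simpa using hn), mul_zero, zero_sub]
      have hDn : -((L : ℝ) / 2) ≤ D := neg_half_le_sum_sub_mul_cos (by omega) _
      by_cases hlam2 : lam n ≤ 2 * Λ
      · rw [Set.indicator_of_mem (show n ∈ {n | lam n ≤ 2 * Λ} from hlam2)]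
        have h₁ := mul_nonneg (hf n) (htri n)
        have h₂ := mul_le_of_le_one_right (hf n) (htri_le n)
        nlinarith
      · rw [triangle_eq_zero]
        · simp only [mul_zero, zero_mul]
          nlinarith
        · rw [abs_of_nonneg (by have := hlam n; positivity), le_div_iff₀ (by positivity)]
          linarith

/-- Soundararajan's lemma over an arbitrary countable index set. -/
theorem exists_le_tsum_mul_cos [Countable ι] (hf : ∀ n, 0 ≤ f n) (hlam : ∀ n, 0 ≤ lam n)
    (hs : Summable f) (hL : 2 ≤ L) (hΛ : 0 < Λ)
    (hM : ∀ m ∈ M, lam m ∈ Set.Icc (Λ / 2) (3 * Λ / 2)) {T : ℝ} (hT : 0 < T) :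
    ∃ t ∈ Set.Icc (T / 2) (((6 * L : ℕ) : ℝ) ^ (M.card + 1) * T),
      (1 / 8) * ∑ m ∈ M, f m - (1 / ((L : ℝ) - 1)) * ∑' n, {n | lam n ≤ 2 * Λ}.indicator f n
        - (2 / (π ^ 2 * T * Λ)) * ∑' n, f n
      ≤ ∑' n, f n * cos (2 * π * lam n * t) := by
  have hL' : (2 : ℝ) ≤ L := by exact_mod_cast hL
  obtain ⟨k, hk1, hkN, hk⟩ := exists_nat_mul_near_int M (fun m => lam m * T)
    (show 0 < 6 * L by omega)
  obtain ⟨l, hl, hlow⟩ := exists_le_tsum_triangle_mul_cos hf hlam hs hL hΛ hM (t := k * T)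
    fun m hm => by simpa only [mul_left_comm] using hk m hm
  obtain ⟨hl1, hlL⟩ := Finset.mem_Ico.1 hl
  have hk1' : (1 : ℝ) ≤ k := by exact_mod_cast hk1
  have hl1' : (1 : ℝ) ≤ l := by exact_mod_cast hl1
  have hlL' : (l : ℝ) ≤ L := by exact_mod_cast hlL.le
  have hkN' : (k : ℝ) ≤ ((6 * L : ℕ) : ℝ) ^ M.card := by exact_mod_cast hkN
  have hkl : (1 : ℝ) ≤ l * k := by nlinarith
  have htop : (l : ℝ) * k + 2 ≤ ((6 * L : ℕ) : ℝ) ^ (M.card + 1) := by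
    have : (l : ℝ) * k ≤ L * ((6 * L : ℕ) : ℝ) ^ M.card := by gcongr
    rw [pow_succ]
    push_cast at this hkN' ⊢
    nlinarith
  rw [← integral_fejerKernel_mul_tsum hΛ hf hs] at hlow
  set S := ∑' n, f n with hSdef
  have hS : 0 ≤ S := tsum_nonneg hf
  set F : ℝ → ℝ := fun t => ∑' n, f n * cos (2 * π * lam n * t) with hF
  have hFS (x : ℝ) : |F x| ≤ S := abs_tsum_mul_cos_le hf hs _
  set τ := 2 / (π ^ 2 * T * Λ) with hτ
  have hτ0 : 0 < τ := by positivity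
  by_contra! hcon
  set C := (1 / 8) * ∑ m ∈ M, f m
    - (1 / ((L : ℝ) - 1)) * ∑' n, {n | lam n ≤ 2 * Λ}.indicator f n - τ * S with hC
  have hFC (x : ℝ) (hx : T / 2 ≤ x) (hx' : x ≤ (l * k + 2) * T) : F x < C :=
    hcon x ⟨hx, hx'.trans (by gcongr)⟩
  have hT1 := hFC T (by linarith) (by nlinarith)
  have hT2 := hFC (2 * T) (by linarith) (by nlinarith)
  have hdouble : -(9 / 8) * S ≤ F T + F (2 * T) := neg_le_tsum_mul_cos_or_double hf hs T
  have hbound (C' : ℝ) (hC' : C' ≤ S)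
      (h : ∀ x ∈ Set.Icc (l * (k * T) - T / 2) (l * (k * T) + 2 * T), F x ≤ C') :=
    integral_fejerKernel_mul_le hΛ (continuous_tsum_mul_cos hf hs) hT hFS hC' h
  have hmeanS := hbound S le_rfl fun x _ => (abs_le.1 (hFS x)).2
  have hCS : C ≤ S := by nlinarith
  have hmeanC := hbound C hCS fun x hx =>
    (hFC x (by nlinarith [hx.1]) (by nlinarith [hx.2])).le
  have hτ' : 5 / (4 * π ^ 2 * T * Λ) = 5 / 8 * τ := by
    rw [hτ]; field_simp; norm_num
  rw [hτ'] at hmeanC hmeanS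
  rcases hS.eq_or_lt with hS0 | hS0
  · have := (abs_le.1 (hFS T)).1
    nlinarith
  · have h₁ : τ * S ≤ (S - C) * (5 / 8 * τ) := by linarith
    have h₂ : S - C ≤ 25 / 16 * S := by linarith
    nlinarith [mul_pos hτ0 hS0]

end Resonance

/-- Soundararajan's Lemma. -/
theorem stmt_1 (f lam : ℕ → ℝ)
    (hf_nonneg : ∀ n : ℕ, 1 ≤ n → 0 ≤ f n)
    (hlam_nonneg : ∀ n : ℕ, 1 ≤ n → 0 ≤ lam n)
    (hlam_mono : ∀ m n : ℕ, 1 ≤ m → m ≤ n → lam m ≤ lam n)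
    (hf_sum : Summable (fun n : {n : ℕ // 1 ≤ n} => f n))
    (L : ℕ) (hL : 2 ≤ L) (Λ : ℝ) (hΛ : 0 < Λ)
    (M : Finset ℕ) (hM : ∀ m ∈ M, 1 ≤ m ∧ lam m ∈ Set.Icc (Λ / 2) (3 * Λ / 2)) :
    ∀ T : ℝ, 2 ≤ T → ∃ t : ℝ, t ∈ Set.Icc (T / 2) (((6 * L : ℕ) : ℝ) ^ (M.card + 1) * T) ∧
      (1 / 8) * ∑ m ∈ M, f m
        - (1 / ((L : ℝ) - 1)) * ∑' n : {n : ℕ // 1 ≤ n ∧ lam n ≤ 2 * Λ}, f n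
        - (2 / (Real.pi ^ 2 * T * Λ)) * ∑' n : {n : ℕ // 1 ≤ n}, f n
      ≤ ∑' n : {n : ℕ // 1 ≤ n}, f n * Real.cos (2 * Real.pi * lam n * t) := by
  intro T hT
  have h := exists_le_tsum_mul_cos (ι := {n : ℕ // 1 ≤ n}) (f := fun n => f n)
    (lam := fun n => lam n) (M := M.subtype (1 ≤ ·)) (fun n => hf_nonneg n n.2)
    (fun n => hlam_nonneg n n.2) hf_sum hL hΛ
    (fun m hm => (hM m (Finset.mem_subtype.1 hm)).2) (T := T) (by linarith)
  have hfilter : M.filter (1 ≤ ·) = M := Finset.filter_true_of_mem fun m hm => (hM m hm).1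
  have hsum : ∑ m ∈ M.subtype (1 ≤ ·), f m = ∑ m ∈ M, f m := by
    rw [← Finset.sum_filter_add_sum_filter_not M (1 ≤ ·)]
    rw [Finset.sum_subtype_eq_sum_filter, hfilter]
    rw [Finset.filter_false_of_mem fun m hm => not_not.2 (hM m hm).1]
    simp
  have htsum : ∑' n : {n : ℕ // 1 ≤ n}, {n : {n : ℕ // 1 ≤ n} | lam n ≤ 2 * Λ}.indicator
      (fun n => f n) n = ∑' n : {n : ℕ // 1 ≤ n ∧ lam n ≤ 2 * Λ}, f n := by
    rw [← tsum_subtype]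
    exact (Equiv.subtypeSubtypeEquivSubtypeInter (fun n : ℕ => 1 ≤ n)
      (fun n => lam n ≤ 2 * Λ)).tsum_eq (fun n => f n)
  rw [Finset.card_subtype, hfilter, hsum, htsum] at h
  exact h
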